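/- arXiv:2504.09056 — 2 statements merged into one kernel-verified Lean document; each statement's English description precedes it below -/
import Mathlib

section
/- Let r and m be positive integers such that the arithmetic progression r mod m is Carmichael incompatible. Then no Carmichael number is congruent to r mod m. -/
/-- A Carmichael number: a composite positive integer `n` such that `a ^ n ≡ a (mod n)`
for every integer `a`. -/
def IsCarmichael (n : ℕ) : Prop :=
  1 < n ∧ ¬ n.Prime ∧ ∀ a : ℤ, (n : ℤ) ∣ a ^ n - a


/-- The Carmichael lambda function: the exponent of the multiplicative group `(ℤ/nℤ)ˣ`. -/
noncomputable def carmichaelLambda (n : ℕ) : ℕ := Monoid.exponent (ZMod n)ˣ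

/-- The arithmetic progression `r mod m` is Carmichael incompatible, where `g = gcd(r, m)`
and `h = gcd(λ(g), m)`. -/
def CarmichaelIncompatible (r m : ℕ) : Prop :=
  1 < Nat.gcd (Nat.gcd r m) (2 * Nat.totient (Nat.gcd r m)) ∨
  ¬ (Nat.gcd (carmichaelLambda (Nat.gcd r m)) m ∣ r - 1) ∨
  (36 ∣ m ∧ r % 12 = 3 ∧ ((r / Nat.gcd r m) % 12 = 5 ∨ (r / Nat.gcd r m) % 12 = 7))

lemma lambda_dvd_of_carmichael {n g : ℕ} (hn : IsCarmichael n) (hg : g ∣ n) :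
    carmichaelLambda g ∣ n - 1 := by
  obtain ⟨h1, -, h3⟩ := hn
  unfold carmichaelLambda
  apply Monoid.exponent_dvd_of_forall_pow_eq_one
  intro u
  obtain ⟨a, ha⟩ := ZMod.intCast_surjective (u : ZMod g)
  have h4 : ((a ^ n - a : ℤ) : ZMod g) = 0 := by
    rw [ZMod.intCast_zmod_eq_zero_iff_dvd]
    exact (Int.natCast_dvd_natCast.mpr hg).trans (h3 a)
  push_cast at h4
  rw [ha, sub_eq_zero] at h4
  have h5 : u ^ n = u := by
    ext
    push_cast
    exact h4
  have h6 : u ^ (n - 1) * u = 1 * u := by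
    rw [← pow_succ, Nat.sub_add_cancel h1.le, h5, one_mul]
  exact mul_right_cancel h6

lemma carmichael_odd {n : ℕ} (hn : IsCarmichael n) : ¬ 2 ∣ n := by
  intro h2
  have h := hn.2.2 (-1)
  rw [(even_iff_two_dvd.mpr h2).neg_one_pow] at h
  have h' : (n : ℤ) ∣ ((2 : ℕ) : ℤ) := by simpa using h
  have h3 := Nat.le_of_dvd (by norm_num) (Int.natCast_dvd_natCast.mp h')
  have h4 : n = 2 := by have := hn.1; omega
  exact hn.2.1 (h4 ▸ Nat.prime_two)

lemma carmichael_not_nine {n : ℕ} (hn : IsCarmichael n) : ¬ 9 ∣ n := by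
  intro h9
  have h := hn.2.2 3
  have h1 : (9 : ℤ) ∣ 3 ^ n - 3 := (by exact_mod_cast h9 : (9 : ℤ) ∣ n).trans h
  have h2 : (9 : ℤ) ∣ 3 ^ n := by
    have : (3 : ℤ) ^ 2 ∣ 3 ^ n := pow_dvd_pow 3 hn.1
    norm_num at this
    exact this
  omega

lemma carmichael_prime {n p : ℕ} (hn : IsCarmichael n) (hp : p.Prime) (h : p ∣ n) :
    p - 1 ∣ n - 1 := by
  have := Fact.mk hp
  have h1 := lambda_dvd_of_carmichael hn h
  unfold carmichaelLambda at h1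
  rwa [IsCyclic.exponent_eq_card, Nat.card_eq_fintype_card, ZMod.card_units] at h1

lemma carmichael_divisor {n : ℕ} (hn : IsCarmichael n) (h12 : n % 12 = 3) (k : ℕ) :
    k ∣ n → ¬ 3 ∣ k → k % 12 = 1 ∨ k % 12 = 11 := by
  induction k using Nat.recOnMul with
  | zero => intro h; simp at h; omega
  | one => simp
  | prime p hp =>
    intro h h3
    right
    have h1 := carmichael_prime hn hp h
    have h2 : ¬ 2 ∣ p := fun h' => carmichael_odd hn (h'.trans h)
    have h4 : ¬ 4 ∣ p - 1 := fun h' => by have := h'.trans h1; omega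
    have h5 : ¬ 3 ∣ p - 1 := fun h' => by have := h'.trans h1; omega
    have hp1 := hp.one_lt
    have e4 : p % 4 = 3 := by omega
    have e3 : p % 3 = 2 := by omega
    omega
  | mul a b iha ihb =>
    intro h h3
    have ha := iha ((Dvd.intro _ rfl).trans h) (fun h' => h3 (h'.mul_right _))
    have hb := ihb ((Dvd.intro_left _ rfl).trans h) (fun h' => h3 (h'.mul_left _))
    rw [Nat.mul_mod]
    rcases ha with ha | ha <;> rcases hb with hb | hb <;> simp [ha, hb]

theorem no_carmichael_in_incompatible_progression (r m : ℕ) (hr : 0 < r) (hm : 0 < m)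
    (h : CarmichaelIncompatible r m) :
    ∀ n : ℕ, IsCarmichael n → ¬ n ≡ r [MOD m] := by
  intro n hn hmod
  have hgm : Nat.gcd r m ∣ m := Nat.gcd_dvd_right r m
  have hgr : Nat.gcd r m ∣ r := Nat.gcd_dvd_left r m
  have hgn : Nat.gcd r m ∣ n := (hmod.dvd_iff hgm).mpr hgr
  have hg0 : 0 < Nat.gcd r m := Nat.gcd_pos_of_pos_left _ hr
  have hlam := lambda_dvd_of_carmichael hn hgn
  have hn1 := hn.1
  unfold CarmichaelIncompatible at h
  generalize Nat.gcd r m = g at *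
  rcases h with h | h | ⟨h36, hr3, h⟩
  · obtain ⟨p, hp, hpd⟩ := Nat.exists_prime_and_dvd h.ne'
    have hpg : p ∣ g := hpd.trans (Nat.gcd_dvd_left _ _)
    have hpn : p ∣ n := hpg.trans hgn
    rcases (hp.dvd_mul).mp (hpd.trans (Nat.gcd_dvd_right _ _)) with h2 | h2
    · have := (Nat.prime_dvd_prime_iff_eq hp Nat.prime_two).mp h2
      exact carmichael_odd hn (this ▸ hpn)
    · have := Fact.mk hp
      have : NeZero g := ⟨hg0.ne'⟩
      rw [← ZMod.card_units_eq_totient] at h2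
      obtain ⟨u, hu⟩ := exists_prime_orderOf_dvd_card p h2
      have h3 : p ∣ n - 1 := by
        rw [← hu]
        exact (Monoid.order_dvd_exponent u).trans hlam
      have h4 : p ∣ 1 := by
        have := Nat.dvd_sub hpn h3
        rwa [Nat.sub_sub_self hn1.le] at this
      exact hp.one_lt.ne' (Nat.dvd_one.mp h4)
  · apply h
    have h1 := (Nat.gcd_dvd_left (carmichaelLambda g) m).trans hlam
    have h2 := hmod.of_dvd (Nat.gcd_dvd_right (carmichaelLambda g) m)
    have h3 := (Nat.modEq_iff_dvd' hn1.le).mpr h1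
    exact (Nat.modEq_iff_dvd' hr).mp (h3.trans h2)
  · have hn36 : n % 36 = r % 36 := hmod.of_dvd h36
    have h9 := carmichael_not_nine hn
    obtain ⟨k, rfl⟩ := hgn
    obtain ⟨l, rfl⟩ := hgr
    obtain ⟨t, rfl⟩ := hgm
    rw [Nat.mul_div_cancel_left _ hg0] at h
    have hkl : k ≡ l [MOD t] := Nat.ModEq.mul_left_cancel' hg0.ne' hmod
    have hg2 : ¬ 2 ∣ g := fun h' => by
      have := h'.mul_right l
      omega
    have hg9 : ¬ 9 ∣ g := fun h' => h9 (h'.mul_right k)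
    have ht : 12 ∣ t := by
      have h4 : 4 ∣ t := by
        have hc : Nat.Coprime 4 g :=
          Nat.Coprime.pow_left 2 ((Nat.Prime.coprime_iff_not_dvd Nat.prime_two).mpr hg2)
        exact hc.dvd_of_dvd_mul_left ((by norm_num : 4 ∣ 36).trans h36)
      have h3 : 3 ∣ t := by
        by_contra h3
        have hc : Nat.Coprime 9 t :=
          Nat.Coprime.pow_left 2 ((Nat.Prime.coprime_iff_not_dvd Nat.prime_three).mpr h3)
        exact hg9 (hc.dvd_of_dvd_mul_right ((by norm_num : 9 ∣ 36).trans h36))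
      omega
    have hk : k % 12 = l % 12 := hkl.of_dvd ht
    have := carmichael_divisor hn (by omega) k (Dvd.intro_left _ rfl) (by omega)
    omega
end

section
/- For every positive integer n there exist δ > 0 and ε > 0 such that the following holds. Let 𝒜 be a nonempty finite set and let ℬ be a nonempty set of n-tuples (a₁, …, aₙ) of pairwise distinct elements of 𝒜 such that for each a ∈ 𝒜, the number of tuples in ℬ having a as a component is at most ε·|ℬ|. Then the number of functions f : 𝒜 → {1, 2} such that both #{b ∈ ℬ : every component of b lies in f⁻¹(1)} ≥ |ℬ|/2^(2n+1) and #{b ∈ ℬ : every component of b lies in f⁻¹(2)} ≥ |ℬ|/2^(2n+1)} is at least δ · 2^|𝒜|. -/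
open scoped Classical

/-- Colourings that are `0` on `b` and `1` on `c`, for disjoint tuples. -/
theorem rpl_count (n : ℕ) (α : Type) [Fintype α] [DecidableEq α] (b c : Fin n → α)
    (h : ∀ i j, c j ≠ b i) :
    (2 : ℝ) ^ (Fintype.card α) ≤
      ((Finset.univ.filter (fun f : α → Fin 2 =>
        (∀ i, f (b i) = 0) ∧ (∀ i, f (c i) = 1))).card : ℝ) * 2 ^ (2 * n) := by
  set G := Finset.univ.filter (fun f : α → Fin 2 =>
        (∀ i, f (b i) = 0) ∧ (∀ i, f (c i) = 1)) with hG
  let T : Finset ((α → Fin 2) × ((Fin n → Fin 2) × (Fin n → Fin 2))) :=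
    G ×ˢ Finset.univ
  let F : (α → Fin 2) → ((α → Fin 2) × ((Fin n → Fin 2) × (Fin n → Fin 2))) := fun f =>
    (fun a => if ∃ i, b i = a then 0 else if ∃ i, c i = a then 1 else f a, (f ∘ b, f ∘ c))
  have key : (Finset.univ : Finset (α → Fin 2)).card ≤ T.card := by
    apply Finset.card_le_card_of_injOn F
    · intro f _
      simp only [T, F, hG, Finset.coe_product, Set.mem_prod, Finset.mem_coe, Finset.mem_filter,
        Finset.mem_univ, true_and, and_true]
      refine ⟨fun i => ?_, fun i => ?_⟩
      · rw [if_pos ⟨i, rfl⟩]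
      · rw [if_neg, if_pos ⟨i, rfl⟩]
        rintro ⟨j, hj⟩
        exact h j i hj.symm
    · intro f _ g _ hfg
      simp only [F, Prod.mk.injEq] at hfg
      obtain ⟨h1, h2, h3⟩ := hfg
      funext a
      by_cases hb : ∃ i, b i = a
      · obtain ⟨i, rfl⟩ := hb
        exact congrFun h2 i
      · by_cases hc : ∃ i, c i = a
        · obtain ⟨i, rfl⟩ := hc
          exact congrFun h3 i
        · have := congrFun h1 a
          simpa [hb, hc] using this
  have h2 : T.card = G.card * 2 ^ (2 * n) := by
    simp only [T, Finset.card_product, Finset.card_univ, Fintype.card_prod, Fintype.card_fun,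
      Fintype.card_fin]
    ring
  rw [h2] at key
  simp only [Finset.card_univ, Fintype.card_fun, Fintype.card_fin] at key
  exact_mod_cast key

/-- For a fixed tuple `b`, most tuples of `B` are disjoint from `b`. -/
theorem rpl_disj (n : ℕ) (hn : 0 < n) (α : Type) [Fintype α] [DecidableEq α]
    (B : Finset (Fin n → α))
    (hB : ∀ a : α, ((B.filter (fun b => ∃ i : Fin n, b i = a)).card : ℝ)
      ≤ (1 / (4 * n)) * B.card) (b : Fin n → α) :
    (3 / 4 : ℝ) * B.card ≤ ((B.filter (fun c => ∀ i j, c j ≠ b i)).card : ℝ) := by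
  have h1 := Finset.card_filter_add_card_filter_not (s := B) (fun c => ∀ i j, c j ≠ b i)
  have h2 : (B.filter (fun c => ¬ ∀ i j, c j ≠ b i)).card ≤
      ∑ i : Fin n, (B.filter (fun c => ∃ j, c j = b i)).card := by
    refine le_trans (Finset.card_le_card ?_) Finset.card_biUnion_le
    intro c hc
    simp only [Finset.mem_filter, Finset.mem_biUnion, Finset.mem_univ, true_and] at hc ⊢
    obtain ⟨hcB, hc⟩ := hc
    push Not at hc
    obtain ⟨i, j, hij⟩ := hc
    exact ⟨i, hcB, j, hij⟩
  have h3 : (∑ i : Fin n, ((B.filter (fun c => ∃ j, c j = b i)).card : ℝ)) ≤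
      ∑ i : Fin n, (1 / (4 * n) : ℝ) * B.card := Finset.sum_le_sum fun i _ => hB (b i)
  have hn' : (0 : ℝ) < n := by exact_mod_cast hn
  have h4 : (∑ i : Fin n, (1 / (4 * n) : ℝ) * B.card) = B.card / 4 := by
    simp only [Finset.sum_const, Finset.card_univ, Fintype.card_fin, nsmul_eq_mul]
    field_simp
  have h2' : ((B.filter (fun c => ¬ ∀ i j, c j ≠ b i)).card : ℝ) ≤
      ∑ i : Fin n, ((B.filter (fun c => ∃ j, c j = b i)).card : ℝ) := by exact_mod_cast h2
  have h1' : ((B.filter (fun c => ∀ i j, c j ≠ b i)).card : ℝ) +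
    ((B.filter (fun c => ¬ ∀ i j, c j ≠ b i)).card : ℝ) = B.card := by exact_mod_cast h1
  linarith

theorem random_partition_lemma (n : ℕ) (hn : 0 < n) :
    ∃ δ : ℝ, 0 < δ ∧ ∃ ε : ℝ, 0 < ε ∧
      ∀ (α : Type) [Fintype α] [DecidableEq α] [Nonempty α],
        ∀ B : Finset (Fin n → α), B.Nonempty →
          (∀ b ∈ B, Function.Injective b) →
          (∀ a : α, ((B.filter (fun b => ∃ i : Fin n, b i = a)).card : ℝ) ≤ ε * B.card) →
          δ * 2 ^ (Fintype.card α) ≤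
            ((Finset.univ.filter (fun f : α → Fin 2 =>
                (B.card : ℝ) / 2 ^ (2 * n + 1) ≤
                  ((B.filter (fun b => ∀ i : Fin n, f (b i) = 0)).card : ℝ) ∧
                (B.card : ℝ) / 2 ^ (2 * n + 1) ≤
                  ((B.filter (fun b => ∀ i : Fin n, f (b i) = 1)).card : ℝ))).card : ℝ) := by
  have hn' : (0 : ℝ) < n := by exact_mod_cast hn
  refine ⟨1 / (4 * 2 ^ (2 * n)), by positivity, 1 / (4 * n), by positivity, ?_⟩
  intro α _ _ _ B hne _ hB
  have hBpos : (0 : ℝ) < B.card := by exact_mod_cast hne.card_pos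
  set X : (α → Fin 2) → ℝ := fun f => ((B.filter (fun b => ∀ i : Fin n, f (b i) = 0)).card : ℝ)
    with hX
  set Y : (α → Fin 2) → ℝ := fun f => ((B.filter (fun b => ∀ i : Fin n, f (b i) = 1)).card : ℝ)
    with hY
  set K : ℝ := 2 ^ (2 * n) with hK
  have hKpos : 0 < K := by positivity
  set m : ℝ := (B.card : ℝ) with hm
  set N : ℝ := 2 ^ (Fintype.card α) with hN
  have hX0 : ∀ f, 0 ≤ X f := fun f => Nat.cast_nonneg _
  have hY0 : ∀ f, 0 ≤ Y f := fun f => Nat.cast_nonneg _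
  have hXm : ∀ f, X f ≤ m := fun f => by
    simp only [hX, hm]; exact_mod_cast Finset.card_filter_le _ _
  have hYm : ∀ f, Y f ≤ m := fun f => by
    simp only [hY, hm]; exact_mod_cast Finset.card_filter_le _ _
  have hpow : (2 : ℝ) ^ (2 * n + 1) = 2 * K := by rw [pow_succ, hK]; ring
  rw [hpow]
  set S := Finset.univ.filter (fun f : α → Fin 2 => m / (2 * K) ≤ X f ∧ m / (2 * K) ≤ Y f) with hS
  -- upper bound
  have hup : ∑ f : α → Fin 2, X f * Y f ≤ (S.card : ℝ) * m ^ 2 + N * (m ^ 2 / (2 * K)) := by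
    have : ∀ f ∈ (Finset.univ : Finset (α → Fin 2)), X f * Y f ≤
        (if m / (2 * K) ≤ X f ∧ m / (2 * K) ≤ Y f then m ^ 2 else 0) + m ^ 2 / (2 * K) := by
      intro f _
      have hp : 0 ≤ m ^ 2 / (2 * K) := by positivity
      have he : m ^ 2 / (2 * K) = m / (2 * K) * m := by ring
      split_ifs with hf
      · have := mul_le_mul (hXm f) (hYm f) (hY0 f) hBpos.le
        nlinarith
      · rw [zero_add, he]
        by_cases h1 : m / (2 * K) ≤ X f
        · have h2 : Y f ≤ m / (2 * K) := by
            by_contra h3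
            exact hf ⟨h1, (not_le.mp h3).le⟩
          rw [mul_comm]
          exact mul_le_mul h2 (hXm f) (hX0 f) (by positivity)
        · exact mul_le_mul (not_le.mp h1).le (hYm f) (hY0 f) (by positivity)
    refine (Finset.sum_le_sum this).trans (le_of_eq ?_)
    rw [Finset.sum_add_distrib, ← Finset.sum_filter, Finset.sum_const, Finset.sum_const,
      nsmul_eq_mul, nsmul_eq_mul, Finset.card_univ, Fintype.card_fun, Fintype.card_fin]
    push_cast
    rfl
  -- lower bound
  have hlow : (3 / 4) * m ^ 2 * (N / K) ≤ ∑ f : α → Fin 2, X f * Y f := by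
    have e1 : ∑ f : α → Fin 2, X f * Y f = ∑ b ∈ B, ∑ c ∈ B,
        ((Finset.univ.filter (fun f : α → Fin 2 =>
          (∀ i, f (b i) = 0) ∧ (∀ i, f (c i) = 1))).card : ℝ) := by
      have e2 : ∀ f : α → Fin 2, X f * Y f = ∑ b ∈ B, ∑ c ∈ B,
          (if (∀ i, f (b i) = 0) ∧ (∀ i, f (c i) = 1) then (1 : ℝ) else 0) := by
        intro f
        simp only [hX, hY, Finset.card_filter, Nat.cast_sum, Finset.sum_mul_sum]
        refine Finset.sum_congr rfl fun b _ => Finset.sum_congr rfl fun c _ => ?_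
        by_cases h1 : ∀ i, f (b i) = 0 <;> by_cases h2 : ∀ i, f (c i) = 1 <;> simp [h1, h2]
      rw [Finset.sum_congr rfl fun f _ => e2 f, Finset.sum_comm]
      refine Finset.sum_congr rfl fun b _ => ?_
      rw [Finset.sum_comm]
      refine Finset.sum_congr rfl fun c _ => ?_
      rw [Finset.sum_boole]
    rw [e1]
    have e3 : ∀ b ∈ B, (3 / 4) * m * (N / K) ≤ ∑ c ∈ B,
        ((Finset.univ.filter (fun f : α → Fin 2 =>
          (∀ i, f (b i) = 0) ∧ (∀ i, f (c i) = 1))).card : ℝ) := by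
      intro b _
      have hd := rpl_disj n hn α B hB b
      calc (3 / 4) * m * (N / K)
          ≤ ((B.filter (fun c => ∀ i j, c j ≠ b i)).card : ℝ) * (N / K) :=
            mul_le_mul_of_nonneg_right hd (by positivity)
        _ = ∑ c ∈ B.filter (fun c => ∀ i j, c j ≠ b i), N / K := by
            rw [Finset.sum_const, nsmul_eq_mul]
        _ ≤ ∑ c ∈ B.filter (fun c => ∀ i j, c j ≠ b i),
            ((Finset.univ.filter (fun f : α → Fin 2 =>
              (∀ i, f (b i) = 0) ∧ (∀ i, f (c i) = 1))).card : ℝ) := by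
            refine Finset.sum_le_sum fun c hc => ?_
            rw [div_le_iff₀ hKpos]
            exact rpl_count n α b c (Finset.mem_filter.mp hc).2
        _ ≤ _ := Finset.sum_le_sum_of_subset_of_nonneg (Finset.filter_subset _ _)
            fun _ _ _ => Nat.cast_nonneg _
    have e4 := Finset.sum_le_sum e3
    rw [Finset.sum_const, nsmul_eq_mul] at e4
    refine le_trans (le_of_eq ?_) e4
    rw [← hm]; ring
  have hfin := hlow.trans hup
  have h5 : m ^ 2 * (1 / (4 * K) * N) ≤ m ^ 2 * (S.card : ℝ) := by
    have a1 : (3 / 4) * m ^ 2 * (N / K) - N * (m ^ 2 / (2 * K)) = m ^ 2 * (1 / (4 * K) * N) := by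
      field_simp
      ring
    linarith
  exact le_of_mul_le_mul_left h5 (by positivity)
end
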